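/- Assume p(0) ≠ 0. Then the direct sum A(p;q)₁ ⊕ A(p;q)₋₁ of the degree 1 and degree −1 homogeneous components of A(p;q) is a free left module of rank 2 over the degree-zero subalgebra B := A(p;q)₀ (and likewise a free right B-module of rank 2). -/

import Mathlib

noncomputable section

open Polynomial
open scoped Classical

namespace GWAPaper

variable (K : Type) [Field K]

/-- Defining relations of the generalized Weyl algebra `A(p;q)`; the generators are
indexed by `Fin 4` with `0 ↦ x₊`, `1 ↦ x₋`, `2 ↦ z₊`, `3 ↦ z₋`. -/
inductive GWARel (q : K) (p : K[X]) :
    FreeAlgebra K (Fin 4) → FreeAlgebra K (Fin 4) → Prop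
  | zz : GWARel q p (FreeAlgebra.ι K (2 : Fin 4) * FreeAlgebra.ι K (3 : Fin 4))
      (FreeAlgebra.ι K (3 : Fin 4) * FreeAlgebra.ι K (2 : Fin 4))
  | xpzp : GWARel q p (FreeAlgebra.ι K (0 : Fin 4) * FreeAlgebra.ι K (2 : Fin 4))
      (q⁻¹ • (FreeAlgebra.ι K (2 : Fin 4) * FreeAlgebra.ι K (0 : Fin 4)))
  | xpzm : GWARel q p (FreeAlgebra.ι K (0 : Fin 4) * FreeAlgebra.ι K (3 : Fin 4))
      (q⁻¹ • (FreeAlgebra.ι K (3 : Fin 4) * FreeAlgebra.ι K (0 : Fin 4)))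
  | xmzp : GWARel q p (FreeAlgebra.ι K (1 : Fin 4) * FreeAlgebra.ι K (2 : Fin 4))
      (q • (FreeAlgebra.ι K (2 : Fin 4) * FreeAlgebra.ι K (1 : Fin 4)))
  | xmzm : GWARel q p (FreeAlgebra.ι K (1 : Fin 4) * FreeAlgebra.ι K (3 : Fin 4))
      (q • (FreeAlgebra.ι K (3 : Fin 4) * FreeAlgebra.ι K (1 : Fin 4)))
  | xpxm : GWARel q p (FreeAlgebra.ι K (0 : Fin 4) * FreeAlgebra.ι K (1 : Fin 4))
      (Polynomial.aeval (FreeAlgebra.ι K (2 : Fin 4) * FreeAlgebra.ι K (3 : Fin 4)) p)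
  | xmxp : GWARel q p (FreeAlgebra.ι K (1 : Fin 4) * FreeAlgebra.ι K (0 : Fin 4))
      (Polynomial.aeval ((q ^ 2 : K) • (FreeAlgebra.ι K (3 : Fin 4) * FreeAlgebra.ι K (2 : Fin 4))) p)

/-- The generalized Weyl algebra `A(p;q)`. -/
abbrev GWA (q : K) (p : K[X]) : Type := RingQuot (GWARel K q p)

/-- The images of the four generators in `A(p;q)`. -/
def gwaGen (q : K) (p : K[X]) (i : Fin 4) : GWA K q p :=
  RingQuot.mkAlgHom K (GWARel K q p) (FreeAlgebra.ι K i)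

/-- The generator `x₊`. -/
def xp (q : K) (p : K[X]) : GWA K q p := gwaGen K q p 0
/-- The generator `x₋`. -/
def xm (q : K) (p : K[X]) : GWA K q p := gwaGen K q p 1
/-- The generator `z₊`. -/
def zp (q : K) (p : K[X]) : GWA K q p := gwaGen K q p 2
/-- The generator `z₋`. -/
def zm (q : K) (p : K[X]) : GWA K q p := gwaGen K q p 3

/-- ℤ-degrees of the generators: `deg x₊ = deg z₊ = 1`, `deg x₋ = deg z₋ = -1`. -/
def gwaWt : Fin 4 → ℤ := ![1, -1, 1, -1]

/-- The total degree of a word in the generators. -/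
def wordDeg (w : List (Fin 4)) : ℤ := (w.map gwaWt).sum

/-- The product in `A(p;q)` of the letters of a word. -/
def wordVal (q : K) (p : K[X]) (w : List (Fin 4)) : GWA K q p :=
  (w.map (gwaGen K q p)).prod

/-- The degree-`n` homogeneous component of the ℤ-graded algebra `A(p;q)`:
the `K`-linear span of the values of all words of total degree `n`. -/
def component (q : K) (p : K[X]) (n : ℤ) : Submodule K (GWA K q p) :=
  Submodule.span K {a | ∃ w : List (Fin 4), wordDeg w = n ∧ wordVal K q p w = a}

/-- The `q²`-derivative `p_{q²}` of a polynomial `p`, equal to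
`(p(q²z) - p(z))/((q²-1)z)` if `q² ≠ 1` and to `p'` if `q² = 1`. -/
def qDeriv (q : K) (p : K[X]) : K[X] :=
  if q ^ 2 = 1 then derivative p
  else (p.comp (C (q ^ 2) * X) - p) / (C (q ^ 2 - 1) * X)

/-- The polynomial `c(z) = q·p_{q²}(z)`. -/
def cPoly (q : K) (p : K[X]) : K[X] := C q * qDeriv K q p

/-- `p` is `q²`-separable: `p(z)` is coprime with `z·p_{q²}(z)`. -/
def QSeparable (q : K) (p : K[X]) : Prop := IsCoprime p (X * qDeriv K q p)


section FreeOfRankTwo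

variable {K} {A : Type*} [Ring A] [Algebra K A] {𝒞 : ℤ → Submodule K A}

/-- A matrix with columns in degrees `1` and `-1` that has an inverse with rows in degrees `-1`
and `1` gives a basis of `𝒞 1 ⊕ 𝒞 (-1)` as a left module over `𝒞 0`. -/
theorem exists_left_basis [SetLike.GradedMonoid 𝒞] (hd : Disjoint (𝒞 1) (𝒞 (-1)))
    {m₁₁ m₁₂ m₂₁ m₂₂ n₁₁ n₁₂ n₂₁ n₂₂ : A}
    (hm₁₁ : m₁₁ ∈ 𝒞 1) (hm₁₂ : m₁₂ ∈ 𝒞 (-1)) (hm₂₁ : m₂₁ ∈ 𝒞 1) (hm₂₂ : m₂₂ ∈ 𝒞 (-1))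
    (hn₁₁ : n₁₁ ∈ 𝒞 (-1)) (hn₁₂ : n₁₂ ∈ 𝒞 (-1)) (hn₂₁ : n₂₁ ∈ 𝒞 1) (hn₂₂ : n₂₂ ∈ 𝒞 1)
    (hmn : !![m₁₁, m₁₂; m₂₁, m₂₂] * !![n₁₁, n₁₂; n₂₁, n₂₂] = 1)
    (hnm : !![n₁₁, n₁₂; n₂₁, n₂₂] * !![m₁₁, m₁₂; m₂₁, m₂₂] = 1) :
    ∃ s t : A, s ∈ 𝒞 1 ⊔ 𝒞 (-1) ∧ t ∈ 𝒞 1 ⊔ 𝒞 (-1) ∧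
      (∀ m ∈ 𝒞 1 ⊔ 𝒞 (-1), ∃ a ∈ 𝒞 0, ∃ b ∈ 𝒞 0, m = a * s + b * t) ∧
      (∀ a ∈ 𝒞 0, ∀ b ∈ 𝒞 0, a * s + b * t = 0 → a = 0 ∧ b = 0) := by
  refine ⟨m₁₁ + m₁₂, m₂₁ + m₂₂, Submodule.add_mem_sup hm₁₁ hm₁₂,
    Submodule.add_mem_sup hm₂₁ hm₂₂, fun m hm => ?_, fun a ha b hb hab => ?_⟩
  · obtain ⟨y, hy, z, hz, rfl⟩ := Submodule.mem_sup.1 hm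
    refine ⟨y * n₁₁ + z * n₂₁, add_mem (SetLike.mul_mem_graded hy hn₁₁)
      (SetLike.mul_mem_graded hz hn₂₁), y * n₁₂ + z * n₂₂,
      add_mem (SetLike.mul_mem_graded hy hn₁₂) (SetLike.mul_mem_graded hz hn₂₂), ?_⟩
    have h := congrArg (fun N => Matrix.vecMul ![y, z] N) hnm
    simp only [← Matrix.vecMul_vecMul, Matrix.vecMul_one] at h
    have h0 := congrFun h 0
    have h1 := congrFun h 1
    simp [Matrix.vecMul, dotProduct, Fin.sum_univ_two] at h0 h1
    rw [mul_add, mul_add, add_add_add_comm, h0, h1]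
  · have h1 : a * m₁₁ + b * m₂₁ ∈ 𝒞 1 := by
      simpa using add_mem (SetLike.mul_mem_graded ha hm₁₁) (SetLike.mul_mem_graded hb hm₂₁)
    have h2 : a * m₁₂ + b * m₂₂ ∈ 𝒞 (-1) := by
      simpa using add_mem (SetLike.mul_mem_graded ha hm₁₂) (SetLike.mul_mem_graded hb hm₂₂)
    have h3 : (a * m₁₁ + b * m₂₁) + (a * m₁₂ + b * m₂₂) = 0 := by
      rw [← hab, mul_add, mul_add]; abel
    obtain ⟨e1, e2⟩ := (Submodule.disjoint_iff_add_eq_zero.1 hd) h1 h2 h3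
    have h := congrArg (fun N => Matrix.vecMul ![a, b] N) hmn
    simp only [← Matrix.vecMul_vecMul, Matrix.vecMul_one] at h
    have h0 := congrFun h 0
    have h1 := congrFun h 1
    simp [Matrix.vecMul, dotProduct, Fin.sum_univ_two, e1, e2] at h0 h1
    exact ⟨h0.symm, h1.symm⟩

/-- A matrix with rows in degrees `-1` and `1` that has an inverse with columns in degrees `1`
and `-1` gives a basis of `𝒞 1 ⊕ 𝒞 (-1)` as a right module over `𝒞 0`. -/
theorem exists_right_basis [SetLike.GradedMonoid 𝒞] (hd : Disjoint (𝒞 1) (𝒞 (-1)))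
    {m₁₁ m₁₂ m₂₁ m₂₂ n₁₁ n₁₂ n₂₁ n₂₂ : A}
    (hm₁₁ : m₁₁ ∈ 𝒞 (-1)) (hm₁₂ : m₁₂ ∈ 𝒞 (-1)) (hm₂₁ : m₂₁ ∈ 𝒞 1) (hm₂₂ : m₂₂ ∈ 𝒞 1)
    (hn₁₁ : n₁₁ ∈ 𝒞 1) (hn₁₂ : n₁₂ ∈ 𝒞 (-1)) (hn₂₁ : n₂₁ ∈ 𝒞 1) (hn₂₂ : n₂₂ ∈ 𝒞 (-1))
    (hmn : !![m₁₁, m₁₂; m₂₁, m₂₂] * !![n₁₁, n₁₂; n₂₁, n₂₂] = 1)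
    (hnm : !![n₁₁, n₁₂; n₂₁, n₂₂] * !![m₁₁, m₁₂; m₂₁, m₂₂] = 1) :
    ∃ s t : A, s ∈ 𝒞 1 ⊔ 𝒞 (-1) ∧ t ∈ 𝒞 1 ⊔ 𝒞 (-1) ∧
      (∀ m ∈ 𝒞 1 ⊔ 𝒞 (-1), ∃ a ∈ 𝒞 0, ∃ b ∈ 𝒞 0, m = s * a + t * b) ∧
      (∀ a ∈ 𝒞 0, ∀ b ∈ 𝒞 0, s * a + t * b = 0 → a = 0 ∧ b = 0) := by
  refine ⟨m₂₁ + m₁₁, m₂₂ + m₁₂, Submodule.add_mem_sup hm₂₁ hm₁₁,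
    Submodule.add_mem_sup hm₂₂ hm₁₂, fun m hm => ?_, fun a ha b hb hab => ?_⟩
  · obtain ⟨y, hy, z, hz, rfl⟩ := Submodule.mem_sup.1 hm
    refine ⟨n₁₁ * z + n₁₂ * y, add_mem (SetLike.mul_mem_graded hn₁₁ hz)
      (SetLike.mul_mem_graded hn₁₂ hy), n₂₁ * z + n₂₂ * y,
      add_mem (SetLike.mul_mem_graded hn₂₁ hz) (SetLike.mul_mem_graded hn₂₂ hy), ?_⟩
    have h := congrArg (fun N => Matrix.mulVec N ![z, y]) hmn
    simp only [← Matrix.mulVec_mulVec, Matrix.one_mulVec] at h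
    have h0 := congrFun h 0
    have h1 := congrFun h 1
    simp [Matrix.mulVec, dotProduct, Fin.sum_univ_two] at h0 h1
    rw [add_mul, add_mul, add_add_add_comm, h0, h1]
  · have h1 : m₂₁ * a + m₂₂ * b ∈ 𝒞 1 := by
      simpa using add_mem (SetLike.mul_mem_graded hm₂₁ ha) (SetLike.mul_mem_graded hm₂₂ hb)
    have h2 : m₁₁ * a + m₁₂ * b ∈ 𝒞 (-1) := by
      simpa using add_mem (SetLike.mul_mem_graded hm₁₁ ha) (SetLike.mul_mem_graded hm₁₂ hb)
    have h3 : (m₂₁ * a + m₂₂ * b) + (m₁₁ * a + m₁₂ * b) = 0 := by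
      rw [← hab, add_mul, add_mul]; abel
    obtain ⟨e1, e2⟩ := (Submodule.disjoint_iff_add_eq_zero.1 hd) h1 h2 h3
    have h := congrArg (fun N => Matrix.mulVec N ![a, b]) hnm
    simp only [← Matrix.mulVec_mulVec, Matrix.one_mulVec] at h
    have h0 := congrFun h 0
    have h1 := congrFun h 1
    simp [Matrix.mulVec, dotProduct, Fin.sum_univ_two, e1, e2] at h0 h1
    exact ⟨h0.symm, h1.symm⟩

theorem semiconjBy_aeval {x a b : A} (h : SemiconjBy x a b) (r : K[X]) :
    SemiconjBy x (aeval a r) (aeval b r) := by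
  induction r using Polynomial.induction_on' with
  | add f g hf hg => simpa using hf.add_right hg
  | monomial n c =>
    simp only [aeval_monomial]
    exact SemiconjBy.mul_right (Algebra.commutes c x).symm (h.pow_right n)

theorem aeval_mem_zero [SetLike.GradedMonoid 𝒞] {a : A} (ha : a ∈ 𝒞 0) (r : K[X]) :
    aeval a r ∈ 𝒞 0 := by
  have h := (aeval (⟨a, ha⟩ : SetLike.GradeZero.subalgebra 𝒞) r).2
  rwa [← Subalgebra.coe_val, ← aeval_algHom_apply] at h

theorem matrix_mul_eq_one {q c : K} (hq : q ≠ 0) (hc : c ≠ 0) {x y z w r r' : A}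
    (hzz : z * w = w * z) (hxz : x * z = q⁻¹ • (z * x)) (hxw : x * w = q⁻¹ • (w * x))
    (hyz : y * z = q • (z * y)) (hyw : y * w = q • (w * y))
    (hxr : x * r' = r * x) (hyr : y * r = r' * y) (hzr : z * r = r * z) (hwr : w * r = r * w)
    (hzr' : z * r' = r' * z) (hwr' : w * r' = r' * w)
    (hxy : x * y = z * w * r + c • 1) (hyx : y * x = q ^ 2 • (z * w) * r' + c • 1) :
    !![x, q • (r * w); z, y] * (c⁻¹ • !![y, -(q ^ 2 • (r' * w)); -(q⁻¹ • z), x]) = 1 ∧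
      (c⁻¹ • !![y, -(q ^ 2 • (r' * w)); -(q⁻¹ • z), x]) * !![x, q • (r * w); z, y] = 1 := by
  have hzwr : z * w * r = r * w * z := by
    rw [mul_assoc, hwr, ← mul_assoc, hzr, mul_assoc, hzz, mul_assoc]
  have hzwr' : z * w * r' = r' * w * z := by
    rw [mul_assoc, hwr', ← mul_assoc, hzr', mul_assoc, hzz, mul_assoc]
  rw [Matrix.mul_smul, inv_smul_eq_iff₀ hc, Matrix.smul_mul, inv_smul_eq_iff₀ hc]
  constructor
  · ext i j
    fin_cases i <;> fin_cases j
    · simp [Matrix.mul_apply, Fin.sum_univ_two, hxy, hq, smul_smul, hzwr]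
    · simp [Matrix.mul_apply, Fin.sum_univ_two, ← mul_assoc x, hxr]
      simp [mul_assoc, hxw, smul_smul, pow_two, hq]
    · simp [Matrix.mul_apply, Fin.sum_univ_two, hyz, hq]
    · simp [Matrix.mul_apply, Fin.sum_univ_two, hyx, mul_assoc, hwr']
  · ext i j
    fin_cases i <;> fin_cases j
    · simp [Matrix.mul_apply, Fin.sum_univ_two, hyx, hzwr']
    · simp [Matrix.mul_apply, Fin.sum_univ_two, ← mul_assoc y, hyr]
      simp [mul_assoc, hyw, smul_smul, pow_two]
    · simp [Matrix.mul_apply, Fin.sum_univ_two, hxz]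
    · simp [Matrix.mul_apply, Fin.sum_univ_two, hxy, hq, smul_smul, mul_assoc, hwr]

/-- Generators of degrees `1, -1, 1, -1` satisfying the relations of `A(p;q)` with `p(0) ≠ 0` make
`𝒞 1 ⊕ 𝒞 (-1)` free of rank two over `𝒞 0`, as a left and as a right module. -/
theorem exists_bases_of_relations [SetLike.GradedMonoid 𝒞] (hd : Disjoint (𝒞 1) (𝒞 (-1)))
    {q : K} (hq : q ≠ 0) {p : K[X]} (hp0 : p.eval 0 ≠ 0) {x y z w : A}
    (hx : x ∈ 𝒞 1) (hy : y ∈ 𝒞 (-1)) (hz : z ∈ 𝒞 1) (hw : w ∈ 𝒞 (-1))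
    (hzz : z * w = w * z) (hxz : x * z = q⁻¹ • (z * x)) (hxw : x * w = q⁻¹ • (w * x))
    (hyz : y * z = q • (z * y)) (hyw : y * w = q • (w * y))
    (hxy : x * y = aeval (z * w) p) (hyx : y * x = aeval (q ^ 2 • (z * w)) p) :
    (∃ s t : A, s ∈ 𝒞 1 ⊔ 𝒞 (-1) ∧ t ∈ 𝒞 1 ⊔ 𝒞 (-1) ∧
      (∀ m ∈ 𝒞 1 ⊔ 𝒞 (-1), ∃ a ∈ 𝒞 0, ∃ b ∈ 𝒞 0, m = a * s + b * t) ∧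
      (∀ a ∈ 𝒞 0, ∀ b ∈ 𝒞 0, a * s + b * t = 0 → a = 0 ∧ b = 0)) ∧
    (∃ s t : A, s ∈ 𝒞 1 ⊔ 𝒞 (-1) ∧ t ∈ 𝒞 1 ⊔ 𝒞 (-1) ∧
      (∀ m ∈ 𝒞 1 ⊔ 𝒞 (-1), ∃ a ∈ 𝒞 0, ∃ b ∈ 𝒞 0, m = s * a + t * b) ∧
      (∀ a ∈ 𝒞 0, ∀ b ∈ 𝒞 0, s * a + t * b = 0 → a = 0 ∧ b = 0)) := by
  have hu : z * w ∈ 𝒞 0 := by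
    simpa using SetLike.mul_mem_graded hz hw
  have hr := aeval_mem_zero hu p.divX
  have hr' := aeval_mem_zero (Submodule.smul_mem _ (q ^ 2) hu) p.divX
  have hsx : SemiconjBy x (q ^ 2 • (z * w)) (z * w) := by
    rw [SemiconjBy, mul_smul_comm, ← mul_assoc, hxz, smul_mul_assoc, mul_assoc, hxw,
      mul_smul_comm, smul_smul, smul_smul, mul_assoc]
    rw [← mul_assoc z w x, show q ^ 2 * (q⁻¹ * q⁻¹) = 1 by field_simp, one_smul]
  have hsy : SemiconjBy y (z * w) (q ^ 2 • (z * w)) := by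
    rw [SemiconjBy, ← mul_assoc, hyz, smul_mul_assoc, mul_assoc, hyw,
      mul_smul_comm, smul_smul, smul_mul_assoc, mul_assoc, pow_two]
  have hsz : SemiconjBy z (z * w) (z * w) := by
    rw [SemiconjBy, mul_assoc, ← hzz]
  have hsw : SemiconjBy w (z * w) (z * w) := by
    rw [SemiconjBy, ← mul_assoc, ← hzz]
  have hp (a : A) : aeval a p = a * aeval a p.divX + p.eval 0 • 1 := by
    have h := congrArg (aeval a) (X_mul_divX_add p)
    rw [← h]
    simp [Algebra.algebraMap_eq_smul_one, coeff_zero_eq_eval_zero]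
  rw [hp] at hxy hyx
  have hsxr := (semiconjBy_aeval hsx p.divX).eq
  have hsyr := (semiconjBy_aeval hsy p.divX).eq
  have hszr := (semiconjBy_aeval hsz p.divX).eq
  have hszr' := (semiconjBy_aeval (hsz.smul_right (q ^ 2)) p.divX).eq
  have hswr := (semiconjBy_aeval hsw p.divX).eq
  have hswr' := (semiconjBy_aeval (hsw.smul_right (q ^ 2)) p.divX).eq
  generalize aeval (z * w) p.divX = r at *
  generalize aeval (q ^ 2 • (z * w)) p.divX = r' at *
  generalize p.eval 0 = c at *
  obtain ⟨hmn, hnm⟩ := matrix_mul_eq_one hq hp0 hzz hxz hxw hyz hyw hsxr hsyr hszr hswr hszr' hswr'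
    hxy hyx
  have hrw : r * w ∈ 𝒞 (-1) := by
    simpa using SetLike.mul_mem_graded hr hw
  have hrw' : r' * w ∈ 𝒞 (-1) := by
    simpa using SetLike.mul_mem_graded hr' hw
  rw [Matrix.smul_of, Matrix.smul_cons] at hmn hnm
  simp only [Matrix.smul_cons, Matrix.smul_empty] at hmn hnm
  have hn₁₁ := Submodule.smul_mem _ c⁻¹ hy
  have hn₁₂ := Submodule.smul_mem _ c⁻¹ (neg_mem (Submodule.smul_mem _ (q ^ 2) hrw'))
  have hn₂₁ := Submodule.smul_mem _ c⁻¹ (neg_mem (Submodule.smul_mem _ q⁻¹ hz))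
  have hn₂₂ := Submodule.smul_mem _ c⁻¹ hx
  have hm₁₂ := Submodule.smul_mem _ q hrw
  exact ⟨exists_left_basis hd hx hm₁₂ hz hy hn₁₁ hn₁₂ hn₂₁ hn₂₂ hmn hnm,
    exists_right_basis hd hn₁₁ hn₁₂ hn₂₁ hn₂₂ hx hm₁₂ hz hy hnm hmn⟩

end FreeOfRankTwo

section Relations

variable (q : K) (p : K[X])

theorem zp_mul_zm : zp K q p * zm K q p = zm K q p * zp K q p := by
  simpa [zp, zm, gwaGen] using RingQuot.mkAlgHom_rel K (GWARel.zz (q := q) (p := p))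

theorem xp_mul_zp : xp K q p * zp K q p = q⁻¹ • (zp K q p * xp K q p) := by
  simpa [zp, xp, gwaGen] using RingQuot.mkAlgHom_rel K (GWARel.xpzp (q := q) (p := p))

theorem xp_mul_zm : xp K q p * zm K q p = q⁻¹ • (zm K q p * xp K q p) := by
  simpa [zm, xp, gwaGen] using RingQuot.mkAlgHom_rel K (GWARel.xpzm (q := q) (p := p))

theorem xm_mul_zp : xm K q p * zp K q p = q • (zp K q p * xm K q p) := by
  simpa [zp, xm, gwaGen] using RingQuot.mkAlgHom_rel K (GWARel.xmzp (q := q) (p := p))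

theorem xm_mul_zm : xm K q p * zm K q p = q • (zm K q p * xm K q p) := by
  simpa [zm, xm, gwaGen] using RingQuot.mkAlgHom_rel K (GWARel.xmzm (q := q) (p := p))

theorem xp_mul_xm : xp K q p * xm K q p = aeval (zp K q p * zm K q p) p := by
  simpa [zp, zm, xp, xm, gwaGen, ← aeval_algHom_apply] using
    RingQuot.mkAlgHom_rel K (GWARel.xpxm (q := q) (p := p))

theorem xm_mul_xp :
    xm K q p * xp K q p = aeval (q ^ 2 • (zp K q p * zm K q p)) p := by
  rw [zp_mul_zm]
  simpa [zp, zm, xp, xm, gwaGen, ← aeval_algHom_apply] using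
    RingQuot.mkAlgHom_rel K (GWARel.xmxp (q := q) (p := p))

end Relations

section Grading

variable (q : K) (p : K[X])

instance : SetLike.GradedMonoid (component K q p) where
  one_mem := Submodule.subset_span ⟨[], rfl, rfl⟩
  mul_mem i j a b ha hb := by
    have h := Submodule.mul_mem_mul ha hb
    rw [component, component, Submodule.span_mul_span] at h
    refine Submodule.span_mono ?_ h
    rintro _ ⟨_, ⟨v, rfl, rfl⟩, _, ⟨w, rfl, rfl⟩, rfl⟩
    exact ⟨v ++ w, by simp [wordDeg], by simp [wordVal]⟩

theorem gwaGen_mem (i : Fin 4) : gwaGen K q p i ∈ component K q p (gwaWt i) :=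
  Submodule.subset_span ⟨[i], by simp [wordDeg], by simp [wordVal]⟩

/-- The action of `c ∈ Kˣ` on `A(p;q)` that scales each generator by `c ^ deg`. -/
def torusAction (c : K) (hc : c ≠ 0) : GWA K q p →ₐ[K] GWA K q p :=
  RingQuot.liftAlgHom K ⟨FreeAlgebra.lift K fun i => c ^ gwaWt i • gwaGen K q p i, by
    have h1 := zp_mul_zm K q p
    have h2 := xp_mul_zp K q p
    have h3 := xp_mul_zm K q p
    have h4 := xm_mul_zp K q p
    have h5 := xm_mul_zm K q p
    have h6 := xp_mul_xm K q p
    have h7 := xm_mul_xp K q p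
    rw [h1] at h7
    simp only [xp, xm, zp, zm] at h1 h2 h3 h4 h5 h6 h7
    intro x y h
    cases h <;>
      simp [gwaWt, ← aeval_algHom_apply, smul_smul, hc, h1, h2, h3, h4, h5, h6, h7] <;>
      congr 1 <;> field_simp⟩

theorem torusAction_gwaGen (c : K) (hc : c ≠ 0) (i : Fin 4) :
    torusAction K q p c hc (gwaGen K q p i) = c ^ gwaWt i • gwaGen K q p i := by
  simp [torusAction, gwaGen]

theorem torusAction_apply_of_mem (c : K) (hc : c ≠ 0) {n : ℤ} {a : GWA K q p}
    (ha : a ∈ component K q p n) : torusAction K q p c hc a = c ^ n • a := by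
  induction ha using Submodule.span_induction with
  | zero => simp
  | add x y _ _ hx hy => simp [hx, hy]
  | smul k x _ hx => rw [map_smul, hx, smul_comm]
  | mem x hx =>
    obtain ⟨w, rfl, rfl⟩ := hx
    induction w with
    | nil => simp [wordDeg, wordVal]
    | cons i w ih =>
      simp only [wordDeg, wordVal, List.map_cons, List.prod_cons, List.sum_cons, map_mul] at ih ⊢
      rw [ih, torusAction_gwaGen, smul_mul_smul_comm, zpow_add₀ hc]

theorem disjoint_component_one_neg_one [CharZero K] :
    Disjoint (component K q p 1) (component K q p (-1)) := by
  refine Submodule.disjoint_def.2 fun a h h' => ?_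
  have e := (torusAction_apply_of_mem K q p 2 two_ne_zero h).symm.trans
    (torusAction_apply_of_mem K q p 2 two_ne_zero h')
  refine (smul_eq_zero.1 ((sub_smul _ _ a).trans (sub_eq_zero.2 e))).resolve_left ?_
  norm_num

end Grading

/-- If `p(0) ≠ 0` then `A(p;q)₁ ⊕ A(p;q)₋₁` is a free left (and right)
module of rank 2 over the degree-zero subalgebra `B = A(p;q)₀`. -/
theorem spinor_module_free [CharZero K]
    (q : K) (hq : q ≠ 0) (p : K[X])
    (hp0 : p.eval 0 ≠ 0) :
    (∃ s t : GWA K q p,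
      s ∈ component K q p 1 ⊔ component K q p (-1) ∧
      t ∈ component K q p 1 ⊔ component K q p (-1) ∧
      (∀ m ∈ component K q p 1 ⊔ component K q p (-1),
        ∃ a ∈ component K q p 0, ∃ b ∈ component K q p 0, m = a * s + b * t) ∧
      (∀ a ∈ component K q p 0, ∀ b ∈ component K q p 0,
        a * s + b * t = 0 → a = 0 ∧ b = 0)) ∧
    (∃ s t : GWA K q p,
      s ∈ component K q p 1 ⊔ component K q p (-1) ∧
      t ∈ component K q p 1 ⊔ component K q p (-1) ∧
      (∀ m ∈ component K q p 1 ⊔ component K q p (-1),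
        ∃ a ∈ component K q p 0, ∃ b ∈ component K q p 0, m = s * a + t * b) ∧
      (∀ a ∈ component K q p 0, ∀ b ∈ component K q p 0,
        s * a + t * b = 0 → a = 0 ∧ b = 0)) := by
  exact exists_bases_of_relations (disjoint_component_one_neg_one K q p) hq hp0
    (gwaGen_mem K q p 0) (gwaGen_mem K q p 1) (gwaGen_mem K q p 2) (gwaGen_mem K q p 3)
    (zp_mul_zm K q p) (xp_mul_zp K q p) (xp_mul_zm K q p) (xm_mul_zp K q p) (xm_mul_zm K q p)
    (xp_mul_xm K q p) (xm_mul_xp K q p)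

end GWAPaper
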